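/- arXiv:2511.16999 — 3 statements merged into one kernel-verified Lean document; each statement's English description precedes it below -/
import Mathlib

section
/- Let d, n, o be positive integers. If {σ_{a|x}} is an unsteerable assemblage on ℂ^d with inputs x ∈ {0,…,n−1} and outcomes a ∈ {0,…,o−1}, and {F_{a|x}} is any family of positive semidefinite d×d matrices satisfying Σ_{x} F_{λ(x)|x} ≤ I for every deterministic strategy λ : {0,…,n−1} → {0,…,o−1} (in the Loewner order), then Σ_{a,x} Tr(F_{a|x} σ_{a|x}) ≤ 1. -/
open scoped BigOperators ComplexOrder
open Matrix

/-- An assemblage is unsteerable if it admits a local hidden state model indexed by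
deterministic strategies. -/
def Unsteerable {d n o : ℕ} (σ : Fin o → Fin n → Matrix (Fin d) (Fin d) ℂ) : Prop :=
  ∃ σlam : (Fin n → Fin o) → Matrix (Fin d) (Fin d) ℂ,
    (∀ lam, (σlam lam).PosSemidef) ∧ (∑ lam, (σlam lam).trace = 1) ∧
    ∀ a x, σ a x = ∑ lam, if lam x = a then σlam lam else 0

theorem psd_trace_mul_re_nonneg {d : ℕ} {A B : Matrix (Fin d) (Fin d) ℂ}
    (hA : A.PosSemidef) (hB : B.PosSemidef) : 0 ≤ (A * B).trace.re := by
  obtain ⟨C, rfl⟩ : ∃ C : Matrix (Fin d) (Fin d) ℂ, B = Cᴴ * C := by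
    open scoped MatrixOrder in
    exact CStarAlgebra.nonneg_iff_eq_star_mul_self.mp hB.nonneg
  have h := (hA.mul_mul_conjTranspose_same C).trace_nonneg
  have e : (A * (Cᴴ * C)).trace = (C * A * Cᴴ).trace := by
    rw [← Matrix.mul_assoc, Matrix.trace_mul_comm, Matrix.mul_assoc]
  rw [e]
  exact (Complex.le_def.mp h).1

/-- any steering functional `F` that is feasible for the dual SDP
(i.e. `Σ_x F_{λ(x)|x} ≤ I` for every deterministic strategy `λ`) has value at most `1`
on every unsteerable assemblage. -/
theorem unsteerable_value_le_one (d n o : ℕ) (hd : 0 < d) (hn : 0 < n) (ho : 0 < o)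
    (σ : Fin o → Fin n → Matrix (Fin d) (Fin d) ℂ)
    (hσPSD : ∀ a x, (σ a x).PosSemidef) (hσnorm : ∀ x, ∑ a, (σ a x).trace = 1)
    (hσ : Unsteerable σ)
    (F : Fin o → Fin n → Matrix (Fin d) (Fin d) ℂ)
    (hFPSD : ∀ a x, (F a x).PosSemidef)
    (hF : ∀ lam : Fin n → Fin o,
      ((1 : Matrix (Fin d) (Fin d) ℂ) - ∑ x, F (lam x) x).PosSemidef) :
    ∑ a, ∑ x, ((F a x) * (σ a x)).trace.re ≤ 1 := by
  obtain ⟨τ, hτ, hτ1, hστ⟩ := hσ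
  have key : ∑ a, ∑ x, ((F a x) * (σ a x)).trace
      = ∑ lam, ((∑ x, F (lam x) x) * τ lam).trace := by
    simp only [hστ, Finset.mul_sum, Finset.sum_mul, Matrix.trace_sum, mul_ite, mul_zero]
    rw [Finset.sum_comm, Finset.sum_comm (s := (Finset.univ : Finset (Fin n → Fin o)))]
    refine Finset.sum_congr rfl fun x _ => ?_
    rw [Finset.sum_comm]
    refine Finset.sum_congr rfl fun lam _ => ?_
    rw [Finset.sum_eq_single (lam x)]
    · simp
    · intro b _ hb
      simp [Ne.symm hb]
    · simp
  have h : ∑ a, ∑ x, ((F a x) * (σ a x)).trace.re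
      = ∑ lam, ((∑ x, F (lam x) x) * τ lam).trace.re := by
    simpa only [Complex.re_sum] using congrArg Complex.re key
  have h1 : ∑ lam, (τ lam).trace.re = 1 := by
    simpa only [Complex.re_sum, Complex.one_re] using congrArg Complex.re hτ1
  rw [h, ← h1]
  refine Finset.sum_le_sum fun lam _ => ?_
  have := psd_trace_mul_re_nonneg (hF lam) (hτ lam)
  rw [Matrix.sub_mul, Matrix.one_mul, Matrix.trace_sub, Complex.sub_re] at this
  linarith
end

section
/- Let d, n, o be positive integers and let {ρ_{a|x}} be an assemblage on ℂ^d with inputs x ∈ {0,…,n−1} and outcomes a ∈ {0,…,o−1}. If the steering robustness satisfies R({ρ_{a|x}}) = 0, then {ρ_{a|x}} is unsteerable. Equivalently, every steerable assemblage has strictly positive steering robustness. -/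
open scoped BigOperators ComplexOrder
open Matrix

/-- An assemblage: a family of PSD matrices with unit total trace for each input. -/
def IsAssemblage {d n o : ℕ} (ρ : Fin o → Fin n → Matrix (Fin d) (Fin d) ℂ) : Prop :=
  (∀ a x, (ρ a x).PosSemidef) ∧ ∀ x, ∑ a, (ρ a x).trace = 1

/-- The steering robustness of an assemblage. -/
noncomputable def steeringRobustness {d n o : ℕ}
    (ρ : Fin o → Fin n → Matrix (Fin d) (Fin d) ℂ) : ℝ :=
  sInf { s : ℝ | 0 ≤ s ∧ ∃ τ : Fin o → Fin n → Matrix (Fin d) (Fin d) ℂ,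
    IsAssemblage τ ∧
    Unsteerable (fun a x => (1 + (s : ℂ))⁻¹ • (ρ a x + (s : ℂ) • τ a x)) }


lemma psd_entry_bound {d : ℕ} {A : Matrix (Fin d) (Fin d) ℂ} (hA : A.PosSemidef)
    (ht : A.trace ≤ 1) (i j : Fin d) : ‖A i j‖ ≤ 1 := by
  have hdiag : ∀ k, 0 ≤ A k k := fun k => hA.diag_nonneg
  have hle : ∀ k, A k k ≤ 1 := fun k =>
    (Finset.single_le_sum (f := fun k => A k k) (fun k _ => hdiag k) (Finset.mem_univ k)).trans ht
  have h2 := (hA.submatrix ![i, j]).det_nonneg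
  rw [Matrix.det_fin_two] at h2
  simp only [Matrix.submatrix_apply, Matrix.cons_val_zero, Matrix.cons_val_one] at h2
  have hji : A j i = star (A i j) := (hA.1.apply j i).symm
  rw [hji, Complex.star_def, Complex.mul_conj, Complex.normSq_eq_norm_sq] at h2
  have h3 := (Complex.le_def.1 h2).1
  have hi := Complex.le_def.1 (hdiag i)
  have hj := Complex.le_def.1 (hdiag j)
  have hi' := Complex.le_def.1 (hle i)
  have hj' := Complex.le_def.1 (hle j)
  simp only [Complex.sub_re, Complex.mul_re, Complex.ofReal_re, Complex.zero_re, Complex.zero_im,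
    Complex.one_re, Complex.one_im] at h3 hi hj hi' hj'
  rw [← hi.2, ← hj.2] at h3
  have : ‖A i j‖ ^ 2 ≤ 1 := by nlinarith [mul_le_one₀ hi'.1 hj.1 hj'.1]
  nlinarith [norm_nonneg (A i j)]

lemma isClosed_psd (d : ℕ) : IsClosed {A : Matrix (Fin d) (Fin d) ℂ | A.PosSemidef} := by
  simp only [Matrix.posSemidef_iff_dotProduct_mulVec, Set.ofPred_and, Set.ofPred_forall]
  refine IsClosed.inter ?_ (isClosed_iInter fun x => ?_)
  · exact isClosed_eq (by fun_prop) (by fun_prop)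
  · exact isClosed_le (by fun_prop) (by fun_prop)

def lhsSet (d n o : ℕ) : Set ((Fin n → Fin o) → Matrix (Fin d) (Fin d) ℂ) :=
  {σ | (∀ lam, (σ lam).PosSemidef) ∧ ∑ lam, (σ lam).trace = 1}

lemma psd_trace_nonneg {d : ℕ} {A : Matrix (Fin d) (Fin d) ℂ} (hA : A.PosSemidef) :
    0 ≤ A.trace := Finset.sum_nonneg fun _ _ => hA.diag_nonneg

lemma isCompact_lhsSet (d n o : ℕ) : IsCompact (lhsSet d n o) := by
  have hB : IsCompact (Set.pi Set.univ fun _ : Fin n → Fin o => Set.pi Set.univ fun _ : Fin d =>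
      Set.pi Set.univ fun _ : Fin d => Metric.closedBall (0 : ℂ) 1) :=
    isCompact_univ_pi fun _ => isCompact_univ_pi fun _ => isCompact_univ_pi fun _ =>
      isCompact_closedBall _ _
  refine hB.of_isClosed_subset ?_ ?_
  · simp only [lhsSet, Set.ofPred_and, Set.ofPred_forall]
    refine IsClosed.inter (isClosed_iInter fun lam => ?_) ?_
    · have hcont : Continuous (fun σ : (Fin n → Fin o) → Matrix (Fin d) (Fin d) ℂ => σ lam) :=
        continuous_apply lam
      exact (isClosed_psd d).preimage hcont
    · refine isClosed_eq (continuous_finsetSum _ fun lam _ => ?_) continuous_const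
      exact (continuous_apply lam).matrix_trace
  · intro (σ : (Fin n → Fin o) → Matrix (Fin d) (Fin d) ℂ) hσ lam _ i _ j _
    rw [mem_closedBall_zero_iff]
    refine psd_entry_bound (hσ.1 lam) ?_ i j
    rw [← hσ.2]
    exact Finset.single_le_sum (f := fun l => (σ l).trace)
      (fun l _ => psd_trace_nonneg (hσ.1 l)) (Finset.mem_univ lam)

lemma isClosed_unsteerable (d n o : ℕ) :
    IsClosed {σ : Fin o → Fin n → Matrix (Fin d) (Fin d) ℂ | Unsteerable σ} := by
  have hc : Continuous (fun (s : (Fin n → Fin o) → Matrix (Fin d) (Fin d) ℂ)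
      (a : Fin o) (x : Fin n) => ∑ lam, if lam x = a then s lam else 0) := by
    refine continuous_pi fun a => continuous_pi fun x => continuous_finsetSum _ fun lam _ => ?_
    split_ifs
    · exact continuous_apply lam
    · exact continuous_const
  convert ((isCompact_lhsSet d n o).image hc).isClosed using 1
  ext σ
  constructor
  · rintro ⟨s, h1, h2, h3⟩
    exact ⟨s, ⟨h1, h2⟩, by ext1 a; ext1 x; exact (h3 a x).symm⟩
  · rintro ⟨s, ⟨h1, h2⟩, rfl⟩
    exact ⟨s, h1, h2, fun a x => rfl⟩

open scoped MatrixOrder Matrix.Norms.L2Operator in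
lemma psd_exists_le {d : ℕ} {A : Matrix (Fin d) (Fin d) ℂ} (hA : A.PosSemidef) :
    ∃ c : ℝ, 0 < c ∧ ∀ c' : ℝ, c ≤ c' →
      ((c' : ℂ) • (1 : Matrix (Fin d) (Fin d) ℂ) - A).PosSemidef := by
  refine ⟨‖A‖ + 1, by positivity, fun c' hc' => ?_⟩
  have h : IsSelfAdjoint A := hA.1
  have h1 := h.le_algebraMap_norm_self
  rw [Matrix.le_iff, Algebra.algebraMap_eq_smul_one] at h1
  have h2 : ((↑(c' - ‖A‖) : ℂ) • (1 : Matrix (Fin d) (Fin d) ℂ)).PosSemidef :=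
    Matrix.PosSemidef.one.smul (Complex.zero_le_real.2 (by linarith))
  convert h2.add h1 using 1
  rw [← Complex.coe_smul]
  push_cast
  module

lemma robustness_set_nonempty {d n o : ℕ} (hd : 0 < d) (ho : 0 < o)
    (ρ : Fin o → Fin n → Matrix (Fin d) (Fin d) ℂ) (hρ : IsAssemblage ρ) :
    ∃ s : ℝ, 0 ≤ s ∧ ∃ τ : Fin o → Fin n → Matrix (Fin d) (Fin d) ℂ,
    IsAssemblage τ ∧
    Unsteerable (fun a x => (1 + (s : ℂ))⁻¹ • (ρ a x + (s : ℂ) • τ a x)) := by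
  choose c hc0 hc using fun a x => psd_exists_le (hρ.1 a x)
  have hd' : (0 : ℝ) < d := by exact_mod_cast hd
  have ho' : (0 : ℝ) < o := by exact_mod_cast ho
  have hdC : (d : ℂ) ≠ 0 := by exact_mod_cast hd.ne'
  have hoC : (o : ℂ) ≠ 0 := by exact_mod_cast ho.ne'
  obtain ⟨C, hC0, hC⟩ : ∃ C : ℝ, 0 < C ∧ ∀ a x, c a x ≤ C := by
    refine ⟨1 + ∑ a, ∑ x, c a x, ?_, fun a x => ?_⟩
    · have := Finset.sum_nonneg fun a (_ : a ∈ Finset.univ) =>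
        Finset.sum_nonneg fun x (_ : x ∈ Finset.univ) => (hc0 a x).le
      linarith
    · have h1 := Finset.single_le_sum (f := fun x => c a x) (fun x _ => (hc0 a x).le)
        (Finset.mem_univ x)
      have h2 := Finset.single_le_sum (f := fun a => ∑ x, c a x)
        (fun a _ => Finset.sum_nonneg fun x _ => (hc0 a x).le) (Finset.mem_univ a)
      linarith
  obtain ⟨s, hs⟩ : ∃ s : ℝ, s = d * o * C := ⟨_, rfl⟩
  have hs0 : 0 < s := by rw [hs]; positivity
  have hsC : (s : ℂ) ≠ 0 := by exact_mod_cast hs0.ne'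
  have hs1 : (1 + s : ℂ) ≠ 0 := by
    have : (1 + s) ≠ 0 := by positivity
    exact_mod_cast this
  refine ⟨s, hs0.le, fun a x => ((s⁻¹ : ℝ) : ℂ) • ((((1 + s) / (d * o) : ℝ) : ℂ) • 1 - ρ a x),
    ⟨fun a x => ?_, fun x => ?_⟩, fun _ => (((d * o ^ n : ℝ)⁻¹ : ℝ) : ℂ) • 1, fun _ => ?_, ?_, ?_⟩
  · refine Matrix.PosSemidef.smul (hc a x _ ((hC a x).trans ?_))
      (Complex.zero_le_real.2 (by positivity))
    rw [le_div_iff₀ (by positivity), hs]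
    linarith
  · simp only [Matrix.trace_smul, Matrix.trace_sub, Matrix.trace_one, Fintype.card_fin,
      ← Finset.smul_sum, Finset.sum_sub_distrib, hρ.2 x, Finset.sum_const, Finset.card_univ]
    simp only [smul_eq_mul, nsmul_eq_mul]
    push_cast
    field_simp
    ring
  · exact Matrix.PosSemidef.one.smul (Complex.zero_le_real.2 (by positivity))
  · simp only [Matrix.trace_smul, Matrix.trace_one, Fintype.card_fin, Finset.sum_const,
      Finset.card_univ, Fintype.card_fun, smul_eq_mul, nsmul_eq_mul]
    push_cast
    field_simp
  · intro a x
    have hcard : (Finset.univ.filter fun lam : Fin n → Fin o => lam x = a).card * o = o ^ n := by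
      have h1 := Finset.card_eq_sum_card_fiberwise (s := (Finset.univ : Finset (Fin n → Fin o)))
        (t := Finset.univ) (f := fun lam => lam x) (fun _ _ => Finset.mem_coe.2 (Finset.mem_univ _))
      have h2 : ∀ b : Fin o, (Finset.univ.filter fun lam : Fin n → Fin o => lam x = b).card =
          (Finset.univ.filter fun lam : Fin n → Fin o => lam x = a).card := by
        intro b
        refine Finset.card_bij' (fun lam _ => fun y => Equiv.swap a b (lam y))
          (fun lam _ => fun y => Equiv.swap a b (lam y)) ?_ ?_ ?_ ?_ <;> simp +contextual
      simp only [h2, Finset.sum_const, Finset.card_univ, Fintype.card_fun, Fintype.card_fin,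
        smul_eq_mul] at h1
      rw [h1, mul_comm]
    beta_reduce
    rw [← Finset.sum_filter, Finset.sum_const]
    have hcardC : ((Finset.univ.filter fun lam : Fin n → Fin o => lam x = a).card : ℂ) * o
      = o ^ n := by exact_mod_cast hcard
    generalize (Finset.univ.filter fun lam : Fin n → Fin o => lam x = a).card = k at *
    rw [← Nat.cast_smul_eq_nsmul ℂ, smul_smul, smul_smul]
    push_cast
    rw [mul_inv_cancel₀ hsC, one_smul, add_sub_cancel, smul_smul]
    congr 1
    rw [← hcardC]
    have hk : (k : ℂ) ≠ 0 := by
      rintro h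
      rw [h, zero_mul] at hcardC
      exact pow_ne_zero n hoC hcardC.symm
    field_simp

/-- an assemblage with vanishing steering robustness is unsteerable;
equivalently, every steerable assemblage has strictly positive steering robustness. -/
theorem unsteerable_of_robustness_eq_zero (d n o : ℕ) (hd : 0 < d) (hn : 0 < n) (ho : 0 < o)
    (ρ : Fin o → Fin n → Matrix (Fin d) (Fin d) ℂ) (hρ : IsAssemblage ρ)
    (hR : steeringRobustness ρ = 0) :
    Unsteerable ρ := by
  have hne := robustness_set_nonempty hd ho ρ hρ
  have key : ∀ k : ℕ, ∃ s : ℝ, s < 1 / ((k : ℝ) + 1) ∧ 0 ≤ s ∧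
      ∃ τ : Fin o → Fin n → Matrix (Fin d) (Fin d) ℂ, IsAssemblage τ ∧
      Unsteerable (fun a x => (1 + (s : ℂ))⁻¹ • (ρ a x + (s : ℂ) • τ a x)) := by
    intro k
    have hlt : steeringRobustness ρ < 1 / ((k : ℝ) + 1) := by rw [hR]; positivity
    obtain ⟨s, hs, hsk⟩ := exists_lt_of_csInf_lt hne hlt
    exact ⟨s, hsk, hs⟩
  choose s hsk hs0 τ hτ hU using key
  have hs : Filter.Tendsto s Filter.atTop (nhds 0) :=
    squeeze_zero hs0 (fun k => (hsk k).le) tendsto_one_div_add_atTop_nhds_zero_nat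
  have hsC : Filter.Tendsto (fun k => (s k : ℂ)) Filter.atTop (nhds 0) := by
    simpa [Function.comp_def] using (Complex.continuous_ofReal.tendsto 0).comp hs
  suffices hlim : Filter.Tendsto
      (fun k => (fun a x => (1 + (s k : ℂ))⁻¹ • (ρ a x + (s k : ℂ) • τ k a x) :
        Fin o → Fin n → Matrix (Fin d) (Fin d) ℂ)) Filter.atTop (nhds ρ) by
    have hmem : ρ ∈ {σ : Fin o → Fin n → Matrix (Fin d) (Fin d) ℂ | Unsteerable σ} :=
      (isClosed_unsteerable d n o).mem_of_tendsto hlim (Filter.Eventually.of_forall hU)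
    exact hmem
  refine tendsto_pi_nhds.2 fun a => tendsto_pi_nhds.2 fun x => tendsto_pi_nhds.2 fun i =>
    tendsto_pi_nhds.2 fun j => ?_
  have hb : ∀ k, ‖τ k a x i j‖ ≤ 1 := fun k => by
    refine psd_entry_bound ((hτ k).1 a x) ?_ i j
    rw [← (hτ k).2 x]
    exact Finset.single_le_sum (f := fun a => (τ k a x).trace)
      (fun a _ => psd_trace_nonneg ((hτ k).1 a x)) (Finset.mem_univ a)
  have h1 : Filter.Tendsto (fun k => (s k : ℂ) * τ k a x i j) Filter.atTop (nhds 0) := by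
    refine squeeze_zero_norm (fun k => ?_) hs
    rw [norm_mul, Complex.norm_real, Real.norm_of_nonneg (hs0 k)]
    exact mul_le_of_le_one_right (hs0 k) (hb k)
  have h2 : Filter.Tendsto (fun k => (1 + (s k : ℂ))⁻¹) Filter.atTop (nhds 1) := by
    have := (hsC.const_add 1).inv₀ (by simp)
    simpa using this
  have h3 := h2.mul (h1.const_add (ρ a x i j))
  simpa using h3
end

section
/- Fix η ∈ [0,1] and define f : (0,∞) → ℝ by f(t) = √t ((√t − 1)/(√t + 1)) η − ((t√t − 1)/(t(√t + 1))) (1 − η). Then for every real t ≥ 2, the derivative f′(t) is strictly positive if and only if η > ( 2 + √t (3 + t) ) / ( 2 + 3√t + 2 t² + t^{5/2} ). -/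
/-- for fixed `η ∈ [0,1]`, the robustness lower bound
`f(t) = √t((√t−1)/(√t+1))η − ((t√t−1)/(t(√t+1)))(1−η)`, viewed as a function of a real
variable `t`, has strictly positive derivative at any `t ≥ 2` if and only if
`η > (2 + √t(3+t))/(2 + 3√t + 2t² + t^{5/2})`. -/
theorem robustness_bound_deriv_pos_iff (η : ℝ) (hη : η ∈ Set.Icc (0 : ℝ) 1)
    (f : ℝ → ℝ)
    (hf : f = fun t : ℝ =>
      Real.sqrt t * ((Real.sqrt t - 1) / (Real.sqrt t + 1)) * η -
        ((t * Real.sqrt t - 1) / (t * (Real.sqrt t + 1))) * (1 - η)) :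
    ∀ t : ℝ, 2 ≤ t →
      (0 < deriv f t ↔
        η > (2 + Real.sqrt t * (3 + t)) /
          (2 + 3 * Real.sqrt t + 2 * t ^ 2 + t ^ 2 * Real.sqrt t)) := by
  intro t ht
  have ht0 : 0 < t := by linarith
  obtain ⟨s, hs⟩ : ∃ s, s = Real.sqrt t := ⟨_, rfl⟩
  have hs0 : 0 < s := by rw [hs]; exact Real.sqrt_pos.mpr ht0
  have hts : t = s ^ 2 := by rw [hs, Real.sq_sqrt ht0.le]
  have hsq : HasDerivAt Real.sqrt (1 / (2 * s)) t := by
    rw [hs]; exact Real.hasDerivAt_sqrt ht0.ne'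
  have hs1 : Real.sqrt t + 1 ≠ 0 := by rw [← hs]; positivity
  have hd2 : t * (Real.sqrt t + 1) ≠ 0 := mul_ne_zero ht0.ne' hs1
  have hA := (hsq.mul ((hsq.sub_const 1).div (hsq.add_const 1) hs1)).mul_const η
  have hB := ((((hasDerivAt_id t).mul hsq).sub_const 1).div
    ((hasDerivAt_id t).mul (hsq.add_const 1)) hd2).mul_const (1 - η)
  have hD := (hA.sub hB).deriv
  have hval : deriv f t = (η * (2 + 3 * s + 2 * s ^ 4 + s ^ 5) - (2 + s * (3 + s ^ 2))) /
      (2 * s ^ 4 * (s + 1) ^ 2) := by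
    rw [hf]
    refine Eq.trans hD ?_
    simp only [Pi.mul_apply, Pi.div_apply, Pi.sub_apply, id, ← hs]
    rw [hts]
    field_simp
    ring
  rw [hval, ← hs, hts, gt_iff_lt, div_lt_iff₀ (by positivity),
    div_pos_iff_of_pos_right (by positivity), sub_pos]
  have e : 2 + 3 * s + 2 * (s ^ 2) ^ 2 + (s ^ 2) ^ 2 * s = 2 + 3 * s + 2 * s ^ 4 + s ^ 5 := by ring
  rw [e]
end
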